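/- arXiv:1312.0507 — 2 statements merged into one kernel-verified Lean document; each statement's English description precedes it below -/
import Mathlib

section
/- Let E be a directed graph and m ≥ 1 an integer. For every μ ∈ E*, i_m(μ) is a well-defined path in E(m) whose length equals |μ|, whose source is s(i_m(μ)) = [μ]_m, and whose range is r(i_m(μ)) = r(μ). Moreover, the map i_m : E* → E(m)* is injective. -/
/- A directed graph is presented by a vertex type `V`, an edge type `E`, and
source/range maps `gs gr : E → V`.  A finite path is encoded as a pair
`(v, es) : V × List E`: the vertex `v` is the source, and `es` is the list of
edges `μ₁, …, μₙ` (so a vertex is the path `(v, [])` of length 0).  Validity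
of the encoding (`IsPath`): if `es` is nonempty then `v` is the source of the
first edge, and consecutive edges are composable (`gr μᵢ = gs μᵢ₊₁`). -/

variable {V E : Type*}

/-- `(v, es)` is a valid path for the graph structure `(gs, gr)`. -/
def IsPath (gs gr : E → V) (p : V × List E) : Prop :=
  (∀ e ∈ p.2.head?, gs e = p.1) ∧ p.2.Chain' fun a b => gr a = gs b

/-- The range of a path: `gr` of the last edge, or the base vertex for a
length-zero path. -/
def pathRange (gr : E → V) (p : V × List E) : V :=
  p.2.getLast?.elim p.1 gr

/- The graph `E(m)`: its vertices are the paths of length `< m` in `E`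
(encoded in `V × List E`), and its edges are pairs `(e, μ)` with `e ∈ E¹`,
`μ ∈ E^{<m}` and `r(e) = s(μ)` (encoded in `E × (V × List E)`), with range
`r(e, μ) = μ` and source `s(e, μ) = eμ` if `|μ| < m - 1` and
`s(e, μ) = s(e)` (a length-zero path) if `|μ| = m - 1`. -/

/-- The source map of `E(m)` (on raw data). -/
def emSrc (gs : E → V) (m : ℕ) (q : E × (V × List E)) : V × List E :=
  if q.2.2.length < m - 1 then (gs q.1, q.1 :: q.2.2) else (gs q.1, [])

/-- The range map of `E(m)` (on raw data). -/
def emRng (q : E × (V × List E)) : V × List E := q.2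

/-- `p` encodes a vertex of `E(m)`: a valid path in `E` of length `< m`. -/
def IsEmVertex (gs gr : E → V) (m : ℕ) (p : V × List E) : Prop :=
  IsPath gs gr p ∧ p.2.length < m

/-- `q` encodes an edge of `E(m)`: a pair `(e, μ)` with `μ ∈ E^{<m}` and
`r(e) = s(μ)`. -/
def IsEmEdge (gs gr : E → V) (m : ℕ) (q : E × (V × List E)) : Prop :=
  IsEmVertex gs gr m q.2 ∧ gr q.1 = q.2.1

/-- A valid path in the graph `E(m)`: a path for the graph structure
`(emSrc gs m, emRng)` all of whose vertices and edges are genuine vertices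
and edges of `E(m)`. -/
def IsEmPath (gs gr : E → V) (m : ℕ)
    (P : (V × List E) × List (E × (V × List E))) : Prop :=
  IsPath (emSrc gs m) emRng P ∧ IsEmVertex gs gr m P.1 ∧
    ∀ q ∈ P.2, IsEmEdge gs gr m q

/-- The truncation `[μ]_m`: the initial segment of `μ` with
`|[μ]_m| = |μ| mod m`. -/
def imTrunc (m : ℕ) (p : V × List E) : V × List E :=
  (p.1, p.2.take (p.2.length % m))

/-- The edge list of `i_m(μ)`: the `j`-th edge of `i_m(μ)` is
`(μⱼ, [μⱼ₊₁ ⋯ μₙ]_m)`.  This agrees with the definition of `i_m` by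
`i_m(v) = v`, `i_m(μ) = (μ₁, μ₂⋯μₙ)(μ₂, μ₃⋯μₙ)⋯(μₙ, r(μ))` for
`1 ≤ |μ| ≤ m`, and recursively
`i_m(μ) = i_m([μ]_m) i_m(μ′) i_m(μ″)` for `μ = [μ]_m μ′ μ″` with
`|μ′| = m`. -/
def imEdgeList (gr : E → V) (m : ℕ) : List E → List (E × (V × List E))
  | [] => []
  | e :: es => (e, (gr e, es.take (es.length % m))) :: imEdgeList gr m es

/-- The path `i_m(μ)` (raw data): its source vertex is `[μ]_m` and its edges
are given by `imEdgeList`. -/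
def imPath (gr : E → V) (m : ℕ) (p : V × List E) :
    (V × List E) × List (E × (V × List E)) :=
  (imTrunc m p, imEdgeList gr m p.2)

theorem isPath_iff_isChain {gs gr : E → V} {p : V × List E} :
    IsPath gs gr p ↔ (∀ e ∈ p.2.head?, gs e = p.1) ∧ p.2.IsChain fun a b => gr a = gs b :=
  Iff.rfl

theorem isPath_nil (gs gr : E → V) (v : V) : IsPath gs gr (v, []) := by
  simp [isPath_iff_isChain]

theorem isPath_cons {gs gr : E → V} {v : V} {e : E} {es : List E} :
    IsPath gs gr (v, e :: es) ↔ gs e = v ∧ IsPath gs gr (gr e, es) := by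
  cases es with
  | nil => simp [isPath_iff_isChain]
  | cons e' es => simp [isPath_iff_isChain, List.isChain_cons_cons, eq_comm]

theorem pathRange_cons (gr : E → V) (v : V) (e : E) (es : List E) :
    pathRange gr (v, e :: es) = pathRange gr (gr e, es) := by
  cases es using List.reverseRecOn with
  | nil => simp [pathRange]
  | append_singleton es a => 
    simp only [pathRange, ← List.cons_append, List.getLast?_append, List.getLast?_singleton,
      Option.some_or]
    rfl

theorem IsPath.take {gs gr : E → V} {v : V} {es : List E}
    (h : IsPath gs gr (v, es)) (k : ℕ) : IsPath gs gr (v, es.take k) := by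
  induction es generalizing v k with
  | nil => simpa using h
  | cons e es ih =>
    cases k with
    | zero => exact isPath_nil gs gr v
    | succ k =>
      rw [isPath_cons] at h
      exact isPath_cons.2 ⟨h.1, ih h.2 k⟩

theorem IsPath.isEmVertex_imTrunc {gs gr : E → V} {m : ℕ} (hm : 1 ≤ m) {p : V × List E}
    (h : IsPath gs gr p) : IsEmVertex gs gr m (imTrunc m p) := by
  refine ⟨h.take _, ?_⟩
  have := Nat.mod_lt p.2.length hm
  simp only [imTrunc, List.length_take]
  omega

theorem emSrc_imTrunc (gs : E → V) {m : ℕ} (hm : 1 ≤ m) (v : V) (e : E) (es : List E) :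
    emSrc gs m (e, imTrunc m (v, es)) = imTrunc m (gs e, e :: es) := by
  have hlt := Nat.mod_lt es.length hm
  have hle := Nat.mod_le es.length m
  simp only [emSrc, imTrunc, List.length_take, List.length_cons, min_eq_left hle]
  split_ifs with h
  · rw [Nat.add_mod_of_add_mod_lt, Nat.mod_eq_of_lt (a := 1) (by omega), List.take_succ_cons]
    rw [Nat.mod_eq_of_lt (a := 1) (by omega)]
    omega
  · have : (es.length + 1) % m = 0 := by
      rw [← Nat.mod_add_mod, show es.length % m + 1 = m by omega, Nat.mod_self]
    rw [this, List.take_zero]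

theorem IsPath.isEmPath_imPath {gs gr : E → V} {m : ℕ} (hm : 1 ≤ m) {v : V} {es : List E}
    (h : IsPath gs gr (v, es)) : IsEmPath gs gr m (imPath gr m (v, es)) := by
  induction es generalizing v with
  | nil => exact ⟨isPath_nil _ _ _, h.isEmVertex_imTrunc hm, by simp [imPath, imEdgeList]⟩
  | cons e es ih =>
    have hv := h.isEmVertex_imTrunc hm
    obtain ⟨rfl, hes⟩ := isPath_cons.1 h
    obtain ⟨hp, ht, hq⟩ := ih hes
    exact ⟨isPath_cons.2 ⟨emSrc_imTrunc gs hm (gr e) e es, hp⟩, hv,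
      List.forall_mem_cons.2 ⟨⟨ht, rfl⟩, hq⟩⟩

theorem map_fst_imEdgeList (gr : E → V) (m : ℕ) (es : List E) :
    (imEdgeList gr m es).map Prod.fst = es := by
  induction es with
  | nil => rfl
  | cons e es ih => simp [imEdgeList, ih]

theorem pathRange_imPath (gr : E → V) (m : ℕ) (v : V) (es : List E) :
    pathRange emRng (imPath gr m (v, es)) = (pathRange gr (v, es), ([] : List E)) := by
  induction es generalizing v with
  | nil => simp [pathRange, imPath, imEdgeList, imTrunc]
  | cons e es ih =>
    rw [pathRange_cons, ← ih (gr e)]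
    exact pathRange_cons _ _ _ _

theorem imPath_injective (gr : E → V) (m : ℕ) :
    Function.Injective (imPath gr m) := by
  intro p q h
  refine Prod.ext (congrArg (fun P => P.1.1) h) ?_
  rw [← map_fst_imEdgeList gr m p.2, ← map_fst_imEdgeList gr m q.2]
  exact congrArg (fun P => P.2.map Prod.fst) h

/-- Let `(V, E, gs, gr)` be a directed graph and `m ≥ 1`.
For every `μ ∈ E*`, `i_m(μ)` is a well-defined path in `E(m)`, of length
`|μ|`, with source `[μ]_m` and range `r(μ)` (a length-zero path, i.e. a
vertex of `E(m)`).  Moreover `i_m : E* → E(m)*` is injective. -/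
theorem imPath_isPath_length_src_rng_and_injective
    (gs gr : E → V) (m : ℕ) (hm : 1 ≤ m) :
    (∀ p : V × List E, IsPath gs gr p →
      IsEmPath gs gr m (imPath gr m p) ∧
      (imPath gr m p).2.length = p.2.length ∧
      (imPath gr m p).1 = imTrunc m p ∧
      pathRange emRng (imPath gr m p) = (pathRange gr p, ([] : List E))) ∧
    ∀ p q : V × List E, IsPath gs gr p → IsPath gs gr q →
      imPath gr m p = imPath gr m q → p = q := by
  refine ⟨fun p hp => ⟨hp.isEmPath_imPath hm, ?_, rfl, pathRange_imPath gr m p.1 p.2⟩,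
    fun p q _ _ h => imPath_injective gr m h⟩
  simpa [imPath] using congrArg List.length (map_fst_imEdgeList gr m p.2)
end

section
/- Let n ∈ ℕ. Let A be a separable C*-algebra and, for each m ∈ ℕ, let β_m : A → B_m be a *-homomorphism into a C*-algebra B_m. If the sequence (β_m) has an asymptotic order-n factorization through AF algebras, then it has an asymptotic order-n factorization through finite-dimensional C*-algebras. -/
/-- A bundled (possibly non-unital, possibly non-separable) C*-algebra. -/
structure CStarBundle : Type 1 where
  X : Type
  [inst : NonUnitalCStarAlgebra X]

attribute [instance] CStarBundle.inst

/-- An element of a C*-algebra (or of a matrix algebra over one) is positive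
iff it is of the form `star b * b`. -/
def IsPositiveElem {X : Type*} [NonUnitalRing X] [StarRing X] (a : X) : Prop :=
  ∃ b, a = star b * b

/-- A (ℂ-)linear map between C*-algebras is completely positive if all its
matrix amplifications map positive elements to positive elements. -/
def IsCPMap {X Y : Type*} [NonUnitalRing X] [StarRing X] [Module ℂ X]
    [NonUnitalRing Y] [StarRing Y] [Module ℂ Y] (f : X →ₗ[ℂ] Y) : Prop :=
  ∀ (n : ℕ) (M : Matrix (Fin n) (Fin n) X),
    IsPositiveElem M → IsPositiveElem (M.map f)

/-- A map has order zero if it sends pairs of orthogonal positive elements to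
orthogonal elements: `f a * f b = 0` whenever `a, b` are positive with
`a * b = 0`. -/
def IsOrderZero {X Y : Type*} [NonUnitalRing X] [StarRing X] [Module ℂ X]
    [NonUnitalRing Y] [StarRing Y] [Module ℂ Y] (f : X →ₗ[ℂ] Y) : Prop :=
  ∀ a b : X, IsPositiveElem a → IsPositiveElem b → a * b = 0 →
    f a * f b = 0

/-- `(F_m, ψ_m, φ_m)` is an asymptotic order-`n` factorization of the sequence
of *-homomorphisms `β_m : A → B_m` through elements of the class `𝒞` of
C*-algebras: each `F_m` is a direct sum `⊕_{i=0}^{n} F_m^{(i)}` with each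
`F_m^{(i)} ∈ 𝒞`, each `ψ_m : A → F_m` is a CP contraction, each
`φ_m : F_m → B_m` is a CP map whose restriction to each summand `F_m^{(i)}`
is an order-zero CP contraction, and `‖φ_m (ψ_m a) − β_m a‖ → 0` for every
`a ∈ A`. -/
def HasAsympFactorization (n : ℕ) (𝒞 : CStarBundle → Prop) (A : CStarBundle)
    (B : ℕ → CStarBundle) (β : ∀ m, A.X →⋆ₙₐ[ℂ] (B m).X) : Prop :=
  ∃ (F : ℕ → Fin (n + 1) → CStarBundle)
    (ψ : ∀ m, A.X →ₗ[ℂ] (∀ i, (F m i).X))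
    (φ : ∀ m, (∀ i, (F m i).X) →ₗ[ℂ] (B m).X),
    (∀ m i, 𝒞 (F m i)) ∧
    (∀ m, IsCPMap (ψ m) ∧ ∀ a, ‖ψ m a‖ ≤ ‖a‖) ∧
    (∀ m, IsCPMap (φ m)) ∧
    (∀ m (i : Fin (n + 1)),
      IsCPMap ((φ m).comp (LinearMap.single ℂ (fun j => (F m j).X) i)) ∧
      IsOrderZero ((φ m).comp (LinearMap.single ℂ (fun j => (F m j).X) i)) ∧
      ∀ x : (F m i).X,
        ‖(φ m) ((LinearMap.single ℂ (fun j => (F m j).X) i) x)‖ ≤ ‖x‖) ∧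
    ∀ a : A.X,
      Filter.Tendsto (fun m => ‖(φ m) ((ψ m) a) - β m a‖)
        Filter.atTop (nhds 0)

/-- A C*-algebra is AF if it contains an increasing sequence of
finite-dimensional *-subalgebras with dense union. -/
def IsAFAlgebra (A : CStarBundle) : Prop :=
  ∃ S : ℕ → NonUnitalStarSubalgebra ℂ A.X,
    Monotone S ∧ (∀ n, FiniteDimensional ℂ (S n)) ∧
      Dense (⋃ n, (S n : Set A.X))

/-- A C*-algebra is finite-dimensional if it is so as a complex vector
space. -/
def IsFDAlgebra (A : CStarBundle) : Prop := FiniteDimensional ℂ A.X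

section RegularTrace

open scoped ComplexOrder

/-- A linear functional that is nonnegative on all `star x * x` is hermitian. -/
lemma map_star_mul_eq_conj {X : Type*} [NonUnitalRing X] [StarRing X] [Module ℂ X]
    [StarModule ℂ X] [IsScalarTower ℂ X X] [SMulCommClass ℂ X X]
    (f : X →ₗ[ℂ] ℂ) (hf : ∀ x, 0 ≤ f (star x * x)) (x y : X) :
    f (star y * x) = starRingEnd ℂ (f (star x * y)) := by
  have im_eq (z : X) : (f (star z * z)).im = 0 := (Complex.nonneg_iff.1 (hf z)).2.symm
  have h1 := im_eq (x + y)
  have h2 := im_eq (x + Complex.I • y)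
  have hx := im_eq x
  have hy := im_eq y
  simp only [star_add, star_smul, add_mul, mul_add, map_add, smul_mul_assoc, mul_smul_comm,
    map_smul, smul_eq_mul, Complex.add_im, Complex.mul_im, Complex.mul_re, Complex.star_def,
    Complex.conj_I, Complex.neg_re, Complex.neg_im, Complex.I_re, Complex.I_im] at h1 h2
  apply Complex.ext
  · simp only [Complex.conj_re]; linarith
  · simp only [Complex.conj_im]; linarith

/-- The trace of the left regular representation. -/
noncomputable def regTrace (C : Type*) [NonUnitalRing C] [Module ℂ C] [IsScalarTower ℂ C C]
    [SMulCommClass ℂ C C] : C →ₗ[ℂ] ℂ :=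
  LinearMap.trace ℂ C ∘ₗ LinearMap.mul ℂ C

variable {C : Type*} [NonUnitalCStarAlgebra C]

lemma regTrace_apply (x : C) : regTrace C x = LinearMap.trace ℂ C (LinearMap.mul ℂ C x) := rfl

lemma regTrace_mul_comm (x y : C) : regTrace C (x * y) = regTrace C (y * x) := by
  have h (a b : C) : LinearMap.mul ℂ C (a * b) = LinearMap.mul ℂ C a * LinearMap.mul ℂ C b := by
    ext c; simp [mul_assoc]
  rw [regTrace_apply, regTrace_apply, h, h, LinearMap.trace_mul_comm]

lemma eigenvalue_mul_nonneg [PartialOrder C] [StarOrderedRing C] {y : C} (hy : 0 ≤ y) {μ : ℂ}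
    (hμ : Module.End.HasEigenvalue (LinearMap.mul ℂ C y) μ) : 0 ≤ μ := by
  obtain ⟨v, hv⟩ := hμ.exists_hasEigenvector
  have hyv : y * v = μ • v := by simpa using hv.apply_eq_smul
  have hw0 : star v * v ≠ 0 := by simpa using hv.2
  have hw : 0 ≤ star v * v := star_mul_self_nonneg v
  have h1 : 0 ≤ μ • (star v * v) := by
    have := star_left_conjugate_nonneg hy v
    rwa [mul_assoc, hyv, mul_smul_comm] at this
  have him : μ.im = 0 := by
    have hsa := (IsSelfAdjoint.of_nonneg h1).star_eq
    rw [star_smul, (IsSelfAdjoint.of_nonneg hw).star_eq] at hsa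
    exact Complex.conj_eq_iff_im.1 (smul_left_injective ℂ hw0 hsa)
  rw [Complex.nonneg_iff]
  refine ⟨?_, him.symm⟩
  by_contra! hlt
  have hre : μ • (star v * v) = μ.re • (star v * v) := by
    conv_lhs => rw [← Complex.re_add_im μ, him]
    simp
  rw [hre] at h1
  have h2 : 0 ≤ (-μ.re) • (star v * v) := smul_nonneg (by linarith) hw
  rw [neg_smul, neg_nonneg] at h2
  exact hw0 ((smul_eq_zero.1 (le_antisymm h2 h1)).resolve_left hlt.ne)

lemma eq_zero_of_isNilpotent_mul {y : C} (hy : IsSelfAdjoint y)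
    (h : IsNilpotent (LinearMap.mul ℂ C y)) : y = 0 := by
  have key : ∀ k : ℕ, ∀ T : Module.End ℂ C, (∀ v w, star (T v) * w = star v * T w) →
      T ^ 2 ^ k = 0 → T = 0 := by
    intro k
    induction k with
    | zero => intro T _ h; simpa using h
    | succ k ih =>
      intro T hT h
      have h2 : T ^ 2 = 0 := by
        refine ih (T ^ 2) (fun v w => ?_) (by rw [← pow_mul, ← pow_succ']; exact h)
        rw [sq, Module.End.mul_apply, Module.End.mul_apply, hT, hT]
      ext v
      have h3 : star (T v) * T v = 0 := by
        rw [hT, ← Module.End.mul_apply, ← sq, h2]; simp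
      simpa using h3
  obtain ⟨n, hn⟩ := h
  have h0 := key n (LinearMap.mul ℂ C y) (fun v w => by simp [hy.star_eq, mul_assoc])
    (pow_eq_zero_of_le Nat.lt_two_pow_self.le hn)
  have h1 : star y * y = 0 := by
    rw [hy.star_eq]; simpa using LinearMap.congr_fun h0 y
  simpa using h1

variable [FiniteDimensional ℂ C]

lemma regTrace_eq_sum_roots (y : C) :
    regTrace C y = (LinearMap.charpoly (LinearMap.mul ℂ C y)).roots.sum :=
  Module.End.trace_eq_sum_roots_charpoly_of_splits (IsAlgClosed.splits _)

lemma root_charpoly_mul_nonneg [PartialOrder C] [StarOrderedRing C] {y : C} (hy : 0 ≤ y) {μ : ℂ}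
    (hμ : μ ∈ (LinearMap.charpoly (LinearMap.mul ℂ C y)).roots) : 0 ≤ μ :=
  eigenvalue_mul_nonneg hy <| (Module.End.hasEigenvalue_iff_isRoot_charpoly _ _).2
    (Polynomial.isRoot_of_mem_roots hμ)

lemma regTrace_nonneg [PartialOrder C] [StarOrderedRing C] {y : C} (hy : 0 ≤ y) :
    0 ≤ regTrace C y := by
  rw [regTrace_eq_sum_roots]
  exact Multiset.sum_nonneg fun μ hμ => root_charpoly_mul_nonneg hy hμ

lemma eq_zero_of_regTrace_star_mul_self {x : C} (hx : regTrace C (star x * x) = 0) : x = 0 := by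
  let _ := CStarAlgebra.spectralOrder C
  let _ := CStarAlgebra.spectralOrderedRing C
  have hroots : ∀ μ ∈ (LinearMap.charpoly (LinearMap.mul ℂ C (star x * x))).roots, μ = 0 := by
    intro μ hμ
    rw [regTrace_eq_sum_roots] at hx
    refine le_antisymm ?_ (root_charpoly_mul_nonneg (star_mul_self_nonneg x) hμ)
    rw [← hx]
    exact Multiset.single_le_sum
      (fun ν hν => root_charpoly_mul_nonneg (star_mul_self_nonneg x) hν) μ hμ
  have hnil : IsNilpotent (LinearMap.mul ℂ C (star x * x)) := by
    refine ⟨Multiset.card (LinearMap.charpoly (LinearMap.mul ℂ C (star x * x))).roots, ?_⟩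
    have hprod := (IsAlgClosed.splits
      (LinearMap.charpoly (LinearMap.mul ℂ C (star x * x)))).eq_prod_roots
    rw [Multiset.eq_replicate_card.2 hroots, (LinearMap.charpoly_monic _).leadingCoeff] at hprod
    simp only [map_one, Multiset.map_replicate, map_zero, sub_zero, Multiset.prod_replicate,
      one_mul] at hprod
    have hCH := LinearMap.aeval_self_charpoly (LinearMap.mul ℂ C (star x * x))
    rw [hprod] at hCH
    simpa only [map_pow, Polynomial.aeval_X] using hCH
  simpa using eq_zero_of_isNilpotent_mul (IsSelfAdjoint.star_mul_self x) hnil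

lemma regTrace_star_mul_self_nonneg (x : C) : 0 ≤ regTrace C (star x * x) := by
  let _ := CStarAlgebra.spectralOrder C
  let _ := CStarAlgebra.spectralOrderedRing C
  exact regTrace_nonneg (star_mul_self_nonneg x)

/-- A basis in a finite-dimensional vector space that is orthonormal for a given inner product. -/
lemma exists_basis_repr_eq_inner {V : Type*} [AddCommGroup V] [Module ℂ V] [FiniteDimensional ℂ V]
    (core : InnerProductSpace.Core ℂ V) :
    ∃ b : Module.Basis (Fin (Module.finrank ℂ V)) ℂ V, ∀ x i, b.repr x i = core.inner (b i) x := by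
  let _ : NormedAddCommGroup V := @InnerProductSpace.Core.toNormedAddCommGroup ℂ V _ _ _ core
  let _ : InnerProductSpace ℂ V := InnerProductSpace.ofCore core.toCore
  refine ⟨(stdOrthonormalBasis ℂ V).toBasis, fun x i => ?_⟩
  rw [OrthonormalBasis.coe_toBasis_repr_apply, OrthonormalBasis.repr_apply_apply,
    OrthonormalBasis.coe_toBasis]

variable (C) in
/-- A basis of `C` that is orthonormal for the inner product `regTrace (star x * y)`. -/
lemma exists_basis_regTrace : ∃ b : Module.Basis (Fin (Module.finrank ℂ C)) ℂ C,
    ∀ x i, b.repr x i = regTrace C (star (b i) * x) :=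
  exists_basis_repr_eq_inner
    { inner := fun x y => regTrace C (star x * y)
      conj_inner_symm := fun x y =>
        (map_star_mul_eq_conj _ regTrace_star_mul_self_nonneg y x).symm
      re_inner_nonneg := fun x => (Complex.nonneg_iff.1 (regTrace_star_mul_self_nonneg x)).1
      add_left := fun x y z => by simp [add_mul]
      smul_left := fun x y r => by simp [smul_mul_assoc]
      definite := fun x hx => eq_zero_of_regTrace_star_mul_self hx }

variable {ι : Type*} [Fintype ι] (b : Module.Basis ι ℂ C)

lemma sum_mul_star_mul (hb : ∀ x i, b.repr x i = regTrace C (star (b i) * x)) (x : C) :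
    (∑ i, b i * star (b i)) * x = x := by
  classical
  have htr (y : C) : regTrace C y = regTrace C ((∑ i, b i * star (b i)) * y) := by
    rw [regTrace_apply y, LinearMap.trace_eq_matrix_trace ℂ b, Finset.sum_mul, map_sum]
    refine Finset.sum_congr rfl fun i _ => ?_
    rw [Matrix.diag_apply, LinearMap.toMatrix_apply, hb, LinearMap.mul_apply', mul_assoc (b i),
      regTrace_mul_comm (star (b i)), mul_assoc, regTrace_mul_comm y, mul_assoc]
  have h (z : C) : regTrace C (star z * (x - (∑ i, b i * star (b i)) * x)) = 0 := by
    rw [regTrace_mul_comm, sub_mul, mul_assoc, map_sub, ← htr, sub_self]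
  exact (sub_eq_zero.1 (eq_zero_of_regTrace_star_mul_self (h _))).symm

end RegularTrace

section Extension

open scoped ComplexOrder

variable {C F : Type*} [NonUnitalCStarAlgebra C] [NonUnitalCStarAlgebra F]

lemma nonneg_of_map_nonneg [PartialOrder C] [StarOrderedRing C] [PartialOrder F]
    [StarOrderedRing F] {j : C →⋆ₙₐ[ℂ] F} (hj : Function.Injective j) {h : C}
    (hjh : 0 ≤ j h) : 0 ≤ h := by
  have hsa : IsSelfAdjoint h := hj (by rw [map_star, (IsSelfAdjoint.of_nonneg hjh).star_eq])
  have hneg : h⁻ * h * h⁻ = - (h⁻ * h⁻ * h⁻) := by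
    have : h⁻ * (h⁺ - h⁻) * h⁻ = - (h⁻ * h⁻ * h⁻) := by
      rw [mul_sub, CFC.negPart_mul_posPart, zero_sub, neg_mul]
    rwa [CFC.posPart_sub_negPart h hsa] at this
  have hn : IsSelfAdjoint h⁻ := IsSelfAdjoint.of_nonneg (CFC.negPart_nonneg h)
  have h1 : 0 ≤ j (h⁻ * h * h⁻) := by
    have := star_left_conjugate_nonneg hjh (j h⁻)
    rwa [← map_star, hn.star_eq, ← map_mul, ← map_mul] at this
  have h2 : 0 ≤ j (h⁻ * h⁻ * h⁻) := by
    have := star_left_conjugate_nonneg (map_nonneg j (CFC.negPart_nonneg h)) (j h⁻)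
    rwa [← map_star, hn.star_eq, ← map_mul, ← map_mul] at this
  rw [hneg, map_neg, neg_nonneg] at h1
  have h3 : h⁻ * h⁻ * h⁻ = 0 := hj (by rw [le_antisymm h1 h2, map_zero])
  have h4 : h⁻ * h⁻ = 0 := by
    have : star (h⁻ * h⁻) * (h⁻ * h⁻) = 0 := by
      rw [star_mul, hn.star_eq, ← mul_assoc, h3, zero_mul]
    exact (CStarRing.star_mul_self_eq_zero_iff _).1 this
  have h5 : h⁻ = 0 := by
    have : star h⁻ * h⁻ = 0 := by rw [hn.star_eq, h4]
    exact (CStarRing.star_mul_self_eq_zero_iff _).1 this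
  exact CStarAlgebra.nonneg_iff_isSelfAdjoint_and_negPart_eq_zero.2 ⟨hsa, h5⟩

/-- A positive functional on a unital subalgebra of a C*-algebra extends to a positive
functional. -/
lemma exists_positive_extension {j : C →⋆ₙₐ[ℂ] F} (hj : Function.Injective j) {p : C}
    (hpsa : IsSelfAdjoint p) (hp : ∀ x, p * x = x) {τ : C →ₗ[ℂ] ℂ}
    (hτ : ∀ x, 0 ≤ τ (star x * x)) :
    ∃ ω : F →ₗ[ℂ] ℂ, (∀ c, ω (j c) = τ c) ∧ ∀ x, 0 ≤ ω (star x * x) := by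
  let _ := CStarAlgebra.spectralOrder C
  let _ := CStarAlgebra.spectralOrderedRing C
  let _ := CStarAlgebra.spectralOrder F
  let _ := CStarAlgebra.spectralOrderedRing F
  have hp' (x : C) : x * p = x := by
    rw [← star_inj, star_mul, hpsa.star_eq, hp]
  have hjp : star (j p) = j p := by rw [← map_star, hpsa.star_eq]
  have hτ_star (c : C) : τ (star c) = starRingEnd ℂ (τ c) := by
    have := map_star_mul_eq_conj τ hτ p c
    rwa [hp', hpsa.star_eq, hp] at this
  let s : PointedCone ℝ F :=
    { carrier := {y | 0 ≤ j p * (y + star y) * j p}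
      add_mem' := fun {x y} hx hy => by
        simp only [Set.mem_ofPred_eq] at *
        have := add_nonneg hx hy
        rwa [← add_mul, ← mul_add, add_add_add_comm, ← star_add] at this
      zero_mem' := by simp
      smul_mem' := fun r x hx => by
        simp only [Set.mem_ofPred_eq] at *
        have h := smul_nonneg r.2 hx
        have hr : r • x = (r : ℝ) • x := rfl
        rw [hr, star_smul, star_trivial, ← smul_add, mul_smul_comm, smul_mul_assoc]
        exact h }
  let jR : C →ₗ[ℝ] F := (j : C →ₗ[ℂ] F).restrictScalars ℝ
  have hjR : Function.Injective jR := hj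
  let f : F →ₗ.[ℝ] ℝ :=
    { domain := LinearMap.range jR
      toFun := (Complex.reLm ∘ₗ τ.restrictScalars ℝ) ∘ₗ
        (LinearEquiv.ofInjective jR hjR).symm.toLinearMap }
  have hf (c : C) (hc : jR c ∈ f.domain) : f ⟨jR c, hc⟩ = (τ c).re := by
    have : (LinearEquiv.ofInjective jR hjR).symm ⟨jR c, hc⟩ = c :=
      (LinearEquiv.symm_apply_eq _).2 rfl
    change (τ ((LinearEquiv.ofInjective jR hjR).symm ⟨jR c, hc⟩)).re = _
    rw [this]
  obtain ⟨g, hgf, hgs⟩ := riesz_extension s f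
    (by
      rintro ⟨_, c, rfl⟩ hx
      refine (hf c _).symm ▸ ?_
      have hx' : 0 ≤ j (c + star c) := by
        have : 0 ≤ j p * (j c + star (j c)) * j p := hx
        rwa [← map_star, ← map_add, ← map_mul, ← map_mul, hp, hp'] at this
      obtain ⟨d, hd⟩ := CStarAlgebra.nonneg_iff_eq_star_mul_self.1 (nonneg_of_map_nonneg hj hx')
      have h2 := (Complex.nonneg_iff.1 (hτ d)).1
      rw [← hd, map_add, hτ_star, Complex.add_re, Complex.conj_re] at h2
      linarith)
    (by
      intro y
      have hy : IsSelfAdjoint (-(y + star y)) := (IsSelfAdjoint.add_star_self y).neg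
      set N := ‖-(y + star y)‖ with hN
      refine ⟨⟨jR ((N / 2) • p), LinearMap.mem_range_self _ _⟩, ?_⟩
      change 0 ≤ j p * (jR ((N / 2) • p) + y + star (jR ((N / 2) • p) + y)) * j p
      have hjRp : jR ((N / 2) • p) = (N / 2) • j p := jR.map_smul _ _
      have hsplit : (N / 2) • j p + y + star ((N / 2) • j p + y) = N • j p - -(y + star y) := by
        rw [star_add, star_smul, hjp, star_trivial]
        have : N • j p = (N / 2) • j p + (N / 2) • j p := by rw [← add_smul, add_halves]
        rw [this]
        abel
      have hpp : j p * j p = j p := by rw [← map_mul, hp]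
      have h := CStarAlgebra.star_left_conjugate_le_norm_smul (a := j p) hy
      rw [hjp, ← hN, hpp] at h
      rw [hjRp, hsplit, mul_sub, sub_mul, mul_smul_comm, smul_mul_assoc, hpp, hpp, sub_nonneg]
      exact h)
  have hg_skew (y : F) (hy : star y = -y) : g y = 0 := by
    have h1 : y ∈ s := by
      change 0 ≤ j p * (y + star y) * j p
      simp [hy]
    have h2 : -y ∈ s := by
      change 0 ≤ j p * (-y + star (-y)) * j p
      simp [hy]
    have h3 := hgs _ h2
    rw [map_neg] at h3
    linarith [hgs _ h1]
  have hgj (c : C) : g (j c) = (τ c).re := (hgf ⟨jR c, LinearMap.mem_range_self _ _⟩).trans (hf c _)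
  refine ⟨Module.Dual.extendRCLike g, fun c => ?_, fun x => ?_⟩
  · rw [Module.Dual.extendRCLike_apply, ← map_smul, hgj, hgj]
    apply Complex.ext <;> simp
  · rw [Module.Dual.extendRCLike_apply, hg_skew (_ • _) (by simp [star_smul])]
    simp only [map_zero, mul_zero, sub_zero]
    rw [RCLike.ofReal_nonneg]
    refine hgs _ ?_
    change 0 ≤ j p * (star x * x + star (star x * x)) * j p
    have := star_left_conjugate_nonneg (add_nonneg (star_mul_self_nonneg x)
      (star_mul_self_nonneg x)) (j p)
    rw [hjp] at this
    rwa [(IsSelfAdjoint.star_mul_self x).star_eq]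

end Extension

section Positivity

variable {X : Type*} [NonUnitalCStarAlgebra X]

lemma isPositiveElem_iff_nonneg [PartialOrder X] [StarOrderedRing X] {a : X} :
    IsPositiveElem a ↔ 0 ≤ a :=
  CStarAlgebra.nonneg_iff_eq_star_mul_self.symm

lemma IsPositiveElem.sum {σ : Type*} (t : Finset σ) (a : σ → X)
    (ha : ∀ s ∈ t, IsPositiveElem (a s)) : IsPositiveElem (∑ s ∈ t, a s) := by
  let _ := CStarAlgebra.spectralOrder X
  let _ := CStarAlgebra.spectralOrderedRing X
  exact isPositiveElem_iff_nonneg.2 <|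
    Finset.sum_nonneg fun s hs => isPositiveElem_iff_nonneg.1 (ha s hs)

lemma IsPositiveElem.matrix_sum {n : ℕ} {σ : Type*} (t : Finset σ)
    (M : σ → Matrix (Fin n) (Fin n) X) (hM : ∀ s ∈ t, IsPositiveElem (M s)) :
    IsPositiveElem (∑ s ∈ t, M s) := by
  let _ := CStarAlgebra.spectralOrder X
  let _ := CStarAlgebra.spectralOrderedRing X
  exact IsPositiveElem.sum (X := CStarMatrix (Fin n) (Fin n) X) t M hM

lemma isPositiveElem_of_star_mul {n : ℕ} (w : Fin n → X) :
    IsPositiveElem (Matrix.of fun k l => star (w k) * w l) := by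
  cases n with
  | zero => exact ⟨0, Subsingleton.elim _ _⟩
  | succ n =>
    refine ⟨Matrix.of fun i l => if i = 0 then w l else 0, ?_⟩
    ext k l
    simp [Matrix.mul_apply, Matrix.star_apply]

end Positivity

section CompletelyPositive

open scoped ComplexOrder MatrixOrder Matrix.Norms.L2Operator

variable {C F : Type*} [NonUnitalCStarAlgebra C] [NonUnitalCStarAlgebra F]

/-- The Gram matrix of a positive functional factors as `Dᴴ * D`. -/
lemma exists_gram_factor {κ : Type*} [Fintype κ] {ω : F →ₗ[ℂ] ℂ}
    (hω : ∀ x, 0 ≤ ω (star x * x)) (v : κ → F) :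
    ∃ D : Matrix κ κ ℂ, ∀ i k, ω (star (v i) * v k) = ∑ s, star (D s i) * D s k := by
  classical
  have hpos : (Matrix.of fun i k => ω (star (v i) * v k)).PosSemidef := by
    refine Matrix.PosSemidef.of_dotProduct_mulVec_nonneg ?_ fun c => ?_
    · ext i k
      exact (map_star_mul_eq_conj ω hω _ _).symm
    · convert hω (∑ i, c i • v i) using 1
      simp only [dotProduct, Matrix.mulVec, Matrix.of_apply, Pi.star_apply, star_sum, star_smul,
        Finset.sum_mul, Finset.mul_sum, map_sum, smul_mul_assoc, mul_smul_comm, map_smul,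
        smul_eq_mul]
      rw [Finset.sum_comm]
      refine Finset.sum_congr rfl fun k _ => Finset.sum_congr rfl fun i _ => ?_
      ring
  obtain ⟨D, hD⟩ := CStarAlgebra.nonneg_iff_eq_star_mul_self.1 hpos.nonneg
  refine ⟨D, fun i k => ?_⟩
  have := congr_fun (congr_fun hD i) k
  simpa [Matrix.mul_apply, Matrix.star_apply] using this

lemma isCPMap_of_eq_sum {κ : Type*} [Fintype κ] {ω : F →ₗ[ℂ] ℂ}
    (hω : ∀ x, 0 ≤ ω (star x * x)) (u : κ → F) (v : κ → C) {E : F →ₗ[ℂ] C}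
    (hE : ∀ x, E x = ∑ i, ∑ k, ω (star (u i) * x * u k) • (v i * star (v k))) :
    IsCPMap E := by
  classical
  rintro n _ ⟨B, rfl⟩
  have hrow (r : Fin n) :
      IsPositiveElem (Matrix.of fun k l => E (star (B r k) * B r l)) := by
    obtain ⟨D, hD⟩ := exists_gram_factor hω fun q : Fin n × κ => B r q.1 * u q.2
    have hEq : (Matrix.of fun k l => E (star (B r k) * B r l)) =
        ∑ s, Matrix.of fun k l => star (∑ i, D s (k, i) • star (v i)) *
          (∑ i, D s (l, i) • star (v i)) := by
      ext k l
      rw [Matrix.sum_apply, Matrix.of_apply, hE]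
      simp only [Matrix.of_apply, star_sum, star_smul, star_star, Finset.sum_mul, Finset.mul_sum,
        smul_mul_assoc, mul_smul_comm, Finset.smul_sum, smul_smul]
      have hg (i i' : κ) : ω (star (u i) * (star (B r k) * B r l) * u i') =
          ∑ s, star (D s (k, i)) * D s (l, i') := by
        rw [← hD, star_mul]
        simp only [mul_assoc]
      simp only [hg, Finset.sum_smul]
      rw [Finset.sum_comm]
      conv_lhs => enter [2, i]; rw [Finset.sum_comm]
      rw [Finset.sum_comm]
      refine Finset.sum_congr rfl fun s _ => ?_
      refine Finset.sum_congr rfl fun i _ => Finset.sum_congr rfl fun i' _ => ?_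
      rw [mul_comm]
    rw [hEq]
    exact IsPositiveElem.matrix_sum _ _ fun s _ => isPositiveElem_of_star_mul _
  have hsum : (star B * B).map E = ∑ r, Matrix.of fun k l => E (star (B r k) * B r l) := by
    ext k l
    simp [Matrix.sum_apply, Matrix.mul_apply, Matrix.star_apply]
  rw [hsum]
  exact IsPositiveElem.matrix_sum _ _ fun r _ => hrow r

lemma IsCPMap.map_star_mul_self {E : F →ₗ[ℂ] C} (hE : IsCPMap E) (x : F) :
    IsPositiveElem (E (star x * x)) := by
  obtain ⟨B, hB⟩ := hE 1 (Matrix.of fun _ _ => star x * x)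
    ⟨Matrix.of fun _ _ => x, by ext; simp [Matrix.mul_apply, Matrix.star_apply]⟩
  refine ⟨B 0 0, ?_⟩
  simpa [Matrix.mul_apply, Matrix.star_apply] using congr_fun (congr_fun hB 0) 0

end CompletelyPositive

section ConditionalExpectation

variable {C F : Type*} [NonUnitalCStarAlgebra C] [NonUnitalCStarAlgebra F]

/-- A finite-dimensional subalgebra of a C*-algebra is the range of a completely positive
contractive projection. -/
theorem exists_isCPMap_contractive_leftInverse [FiniteDimensional ℂ C] {j : C →⋆ₙₐ[ℂ] F}
    (hj : Function.Injective j) :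
    ∃ E : F →ₗ[ℂ] C, IsCPMap E ∧ (∀ x, ‖E x‖ ≤ ‖x‖) ∧ ∀ c, E (j c) = c := by
  let _ := CStarAlgebra.spectralOrder C
  let _ := CStarAlgebra.spectralOrderedRing C
  let _ := CStarAlgebra.spectralOrder F
  let _ := CStarAlgebra.spectralOrderedRing F
  obtain ⟨b, hb⟩ := exists_basis_regTrace C
  set p : C := ∑ i, b i * star (b i) with hp_def
  have hp (x : C) : p * x = x := sum_mul_star_mul b hb x
  have hpsa : IsSelfAdjoint p := by
    rw [hp_def, IsSelfAdjoint, star_sum]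
    simp only [star_mul, star_star]
  have hp' (x : C) : x * p = x := by
    rw [← star_inj, star_mul, hpsa.star_eq, hp]
  obtain ⟨ω, hωj, hω⟩ := exists_positive_extension hj hpsa hp regTrace_star_mul_self_nonneg
  have expand (x : C) : ∑ i, regTrace C (star (b i) * x) • b i = x := by
    simpa only [hb] using b.sum_repr x
  let E : F →ₗ[ℂ] C := ∑ i, ∑ k, LinearMap.toSpanSingleton ℂ C (b i * star (b k)) ∘ₗ ω ∘ₗ
    LinearMap.mulRight ℂ (j (b k)) ∘ₗ LinearMap.mulLeft ℂ (j (star (b i)))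
  have hE (x : F) : E x = ∑ i, ∑ k, ω (star (j (b i)) * x * j (b k)) • (b i * star (b k)) := by
    simp [E, LinearMap.sum_apply, map_star]
  have hEcp : IsCPMap E := isCPMap_of_eq_sum hω (fun i => j (b i)) b hE
  have hEj (c : C) : E (j c) = c := by
    rw [hE, Finset.sum_comm]
    have h (k i) : ω (star (j (b i)) * j c * j (b k)) • (b i * star (b k)) =
        (regTrace C (star (b i) * (c * b k)) • b i) * star (b k) := by
      rw [← map_star, ← map_mul, ← map_mul, hωj, mul_assoc, smul_mul_assoc]
    simp only [h, ← Finset.sum_mul, expand]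
    simp only [mul_assoc, ← Finset.mul_sum]
    exact hp' c
  have hEstar (x : F) : E (star x) = star (E x) := by
    have hωstar (i k) : ω (star (j (b i)) * star x * j (b k)) =
        star (ω (star (j (b k)) * x * j (b i))) := by
      have := map_star_mul_eq_conj ω hω (j (b k)) (x * j (b i))
      rwa [star_mul, ← mul_assoc] at this
    simp only [hE, star_sum, star_smul, star_mul, star_star, hωstar]
    rw [Finset.sum_comm]
  have hEleft (c : C) (x : F) : E (j c * x) = c * E x := by
    have h1 (i) : star (b i) * c = ∑ l, regTrace C (star (b i) * (c * b l)) • star (b l) := by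
      rw [← star_inj, star_mul, star_star, ← expand (star c * b i), star_sum]
      refine Finset.sum_congr rfl fun l _ => ?_
      have := map_star_mul_eq_conj _ regTrace_star_mul_self_nonneg (b i) (c * b l)
      rw [star_mul, mul_assoc] at this
      rw [star_smul, star_star, this]
      rfl
    have h2 (l) : c * b l = ∑ i, regTrace C (star (b i) * (c * b l)) • b i := (expand _).symm
    have h3 (i k) : ω (star (j (b i)) * (j c * x) * j (b k)) =
        ∑ l, regTrace C (star (b i) * (c * b l)) * ω (star (j (b l)) * x * j (b k)) := by
      rw [← mul_assoc, ← map_star, ← map_mul, h1]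
      simp only [map_sum, map_smul, Finset.sum_mul, smul_mul_assoc, map_star, smul_eq_mul]
    have h4 (l k) : c * (ω (star (j (b l)) * x * j (b k)) • (b l * star (b k))) =
        ∑ i, (regTrace C (star (b i) * (c * b l)) * ω (star (j (b l)) * x * j (b k))) •
          (b i * star (b k)) := by
      rw [mul_smul_comm, ← mul_assoc]
      conv_lhs => rw [h2 l]
      rw [Finset.sum_mul, Finset.smul_sum]
      refine Finset.sum_congr rfl fun i _ => ?_
      rw [smul_mul_assoc, smul_smul, mul_comm]
    simp only [hE, h3, Finset.mul_sum, h4, Finset.sum_smul]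
    rw [Finset.sum_comm]
    conv_lhs => enter [2, k]; rw [Finset.sum_comm]
    rw [Finset.sum_comm]
  have hEright (c : C) (x : F) : E (x * j c) = E x * c := by
    rw [← star_inj, ← hEstar, star_mul, ← map_star, hEleft, star_mul, hEstar]
  have hpos (x : F) : ‖E (star x * x)‖ ≤ ‖star x * x‖ := by
    have hjp : star (j p) = j p := by rw [← map_star, hpsa.star_eq]
    have hcut : E (j p * (star x * x) * j p) = E (star x * x) := by rw [hEright, hEleft, hp, hp']
    have hle : j p * (star x * x) * j p ≤ ‖star x * x‖ • j p := by
      have h := CStarAlgebra.star_left_conjugate_le_norm_smul (a := j p)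
        (IsSelfAdjoint.star_mul_self x)
      rwa [hjp, ← map_mul, hp] at h
    obtain ⟨z, hz⟩ := isPositiveElem_iff_nonneg.2 (sub_nonneg.2 hle)
    have h0 := isPositiveElem_iff_nonneg.1 (hEcp.map_star_mul_self z)
    have hsmul : E (‖star x * x‖ • j p) = ‖star x * x‖ • p := by
      rw [← hEj p, hEj, ← Complex.coe_smul, map_smul, hEj, Complex.coe_smul]
    rw [← hz, map_sub, hcut, hsmul, sub_nonneg] at h0
    have hp1 : ‖p‖ ≤ 1 := by
      have h : ‖p‖ * ‖p‖ = ‖p‖ := by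
        rw [← CStarRing.norm_star_mul_self, hpsa.star_eq, hp]
      nlinarith [norm_nonneg p]
    calc ‖E (star x * x)‖ ≤ ‖‖star x * x‖ • p‖ :=
          CStarAlgebra.norm_le_norm_of_nonneg_of_le
            (isPositiveElem_iff_nonneg.1 (hEcp.map_star_mul_self x)) h0
      _ ≤ ‖star x * x‖ := by
          rw [norm_smul, norm_norm]
          exact mul_le_of_le_one_right (norm_nonneg _) hp1
  refine ⟨E, hEcp, fun x => ?_, hEj⟩
  have hschwarz : star (E x) * E x ≤ E (star x * x) := by
    have h := isPositiveElem_iff_nonneg.1 (hEcp.map_star_mul_self (x - j (E x)))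
    have h2 : E (star (x - j (E x)) * (x - j (E x))) = E (star x * x) - star (E x) * E x := by
      rw [star_sub, ← map_star, sub_mul, mul_sub, mul_sub, map_sub, map_sub, map_sub, hEright,
        hEleft, hEleft, hEj, hEstar]
      abel
    rwa [h2, sub_nonneg] at h
  have h := (CStarAlgebra.norm_le_norm_of_nonneg_of_le (star_mul_self_nonneg _) hschwarz).trans
    (hpos x)
  rw [CStarRing.norm_star_mul_self, CStarRing.norm_star_mul_self] at h
  exact abs_le_of_sq_le_sq' (by simpa only [sq] using h) (norm_nonneg _) |>.2

end ConditionalExpectation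

section Factorization

lemma IsCPMap.comp {X Y Z : Type*} [NonUnitalRing X] [StarRing X] [Module ℂ X]
    [NonUnitalRing Y] [StarRing Y] [Module ℂ Y] [NonUnitalRing Z] [StarRing Z] [Module ℂ Z]
    {g : Y →ₗ[ℂ] Z} {f : X →ₗ[ℂ] Y} (hg : IsCPMap g) (hf : IsCPMap f) : IsCPMap (g ∘ₗ f) := by
  intro n M hM
  have := hg n _ (hf n M hM)
  rwa [Matrix.map_map] at this

lemma isCPMap_of_map_star_mul {X Y : Type*} [NonUnitalRing X] [StarRing X] [Module ℂ X]
    [NonUnitalRing Y] [StarRing Y] [Module ℂ Y] (f : X →ₗ[ℂ] Y)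
    (hf : ∀ x y, f (star x * y) = star (f x) * f y) : IsCPMap f := by
  rintro n _ ⟨B, rfl⟩
  refine ⟨B.map f, ?_⟩
  ext k l
  simp [Matrix.mul_apply, Matrix.star_apply, hf]

lemma isCPMap_pi {ι X : Type*} {Y : ι → Type*} [NonUnitalRing X] [StarRing X] [Module ℂ X]
    [∀ i, NonUnitalRing (Y i)] [∀ i, StarRing (Y i)] [∀ i, Module ℂ (Y i)]
    {f : ∀ i, X →ₗ[ℂ] Y i} (hf : ∀ i, IsCPMap (f i)) : IsCPMap (LinearMap.pi f) := by
  intro n M hM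
  choose B hB using fun i => hf i n M hM
  refine ⟨Matrix.of fun k l i => B i k l, ?_⟩
  ext k l i
  have := congr_fun (congr_fun (hB i) k) l
  simpa [Matrix.mul_apply, Matrix.star_apply] using this

lemma norm_le_sum_norm_of_single {ι E : Type*} [Fintype ι] [DecidableEq ι] {V : ι → Type*}
    [∀ i, NormedAddCommGroup (V i)] [∀ i, NormedSpace ℂ (V i)] [NormedAddCommGroup E]
    [NormedSpace ℂ E] (φ : (∀ i, V i) →ₗ[ℂ] E)
    (hφ : ∀ i (x : V i), ‖φ (LinearMap.single ℂ V i x)‖ ≤ ‖x‖) (x : ∀ i, V i) :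
    ‖φ x‖ ≤ ∑ i, ‖x i‖ := by
  have hx : x = ∑ i, LinearMap.single ℂ V i (x i) := (Finset.univ_sum_single x).symm
  conv_lhs => rw [hx, map_sum]
  exact (norm_sum_le _ _).trans (Finset.sum_le_sum fun i _ => hφ i _)

/-- Finitely many elements of an AF algebra are approximately contained in a finite-dimensional
subalgebra. -/
lemma IsAFAlgebra.exists_approx {F : CStarBundle} (hF : IsAFAlgebra F) (t : Finset F.X) {ε : ℝ}
    (hε : 0 < ε) :
    ∃ (G : CStarBundle) (j : G.X →⋆ₙₐ[ℂ] F.X), IsFDAlgebra G ∧ Function.Injective j ∧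
      ∀ x ∈ t, ∃ c, ‖x - j c‖ < ε := by
  obtain ⟨S, hmono, hfd, hdense⟩ := hF
  have h (x : F.X) : ∃ k, ∃ c ∈ S k, ‖x - c‖ < ε := by
    obtain ⟨c, hc, hxc⟩ := hdense.exists_dist_lt x hε
    obtain ⟨k, hk⟩ := Set.mem_iUnion.1 hc
    exact ⟨k, c, hk, by rwa [← dist_eq_norm]⟩
  choose k c hc hxc using h
  have hfdN := hfd (t.sup k)
  have hclosed : IsClosed (S (t.sup k) : Set F.X) :=
    (S (t.sup k)).toSubmodule.closed_of_finiteDimensional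
  refine ⟨⟨S (t.sup k)⟩, NonUnitalStarSubalgebraClass.subtype (S (t.sup k)), hfdN,
    Subtype.val_injective, fun x hx => ⟨⟨c x, hmono (Finset.le_sup hx) (hc x)⟩, hxc x⟩⟩

/-- One stage of a factorization through AF algebras can be replaced, up to a small error on a
finite set, by one through finite-dimensional algebras. -/
lemma exists_finiteDimensional_factorization {n : ℕ} {A B : CStarBundle}
    {F : Fin (n + 1) → CStarBundle} (hF : ∀ i, IsAFAlgebra (F i))
    {ψ : A.X →ₗ[ℂ] (∀ i, (F i).X)} {φ : (∀ i, (F i).X) →ₗ[ℂ] B.X}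
    (hψ : IsCPMap ψ ∧ ∀ a, ‖ψ a‖ ≤ ‖a‖) (hφ : IsCPMap φ)
    (hφi : ∀ i : Fin (n + 1),
      IsCPMap (φ.comp (LinearMap.single ℂ (fun j => (F j).X) i)) ∧
      IsOrderZero (φ.comp (LinearMap.single ℂ (fun j => (F j).X) i)) ∧
      ∀ x : (F i).X, ‖φ ((LinearMap.single ℂ (fun j => (F j).X) i) x)‖ ≤ ‖x‖)
    (s : Finset A.X) {ε : ℝ} (hε : 0 < ε) :
    ∃ (G : Fin (n + 1) → CStarBundle) (ψ' : A.X →ₗ[ℂ] (∀ i, (G i).X))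
      (φ' : (∀ i, (G i).X) →ₗ[ℂ] B.X),
      (∀ i, IsFDAlgebra (G i)) ∧ (IsCPMap ψ' ∧ ∀ a, ‖ψ' a‖ ≤ ‖a‖) ∧ IsCPMap φ' ∧
      (∀ i : Fin (n + 1),
        IsCPMap (φ'.comp (LinearMap.single ℂ (fun j => (G j).X) i)) ∧
        IsOrderZero (φ'.comp (LinearMap.single ℂ (fun j => (G j).X) i)) ∧
        ∀ x : (G i).X, ‖φ' ((LinearMap.single ℂ (fun j => (G j).X) i) x)‖ ≤ ‖x‖) ∧
      ∀ a ∈ s, ‖φ' (ψ' a) - φ (ψ a)‖ ≤ (n + 1) * (2 * ε) := by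
  classical
  choose G j hG hj happrox using fun i => (hF i).exists_approx (s.image fun a => ψ a i) hε
  have hE (i) := by
    have : FiniteDimensional ℂ (G i).X := hG i
    exact exists_isCPMap_contractive_leftInverse (hj i)
  choose E hEcp hEnorm hEj using hE
  let J : (∀ i, (G i).X) →ₗ[ℂ] (∀ i, (F i).X) :=
    LinearMap.pi fun i => (j i : (G i).X →ₗ[ℂ] (F i).X) ∘ₗ LinearMap.proj i
  have hJcp : IsCPMap J :=
    isCPMap_of_map_star_mul _ fun x y => by ext i; simp [J, map_star]
  have hJsingle (i) : J ∘ₗ LinearMap.single ℂ (fun j => (G j).X) i =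
      LinearMap.single ℂ (fun j => (F j).X) i ∘ₗ (j i : (G i).X →ₗ[ℂ] (F i).X) := by
    ext x k
    rcases eq_or_ne k i with rfl | hk
    · simp [J]
    · simp [J, hk]
  have hjcp (i) : IsCPMap (j i : (G i).X →ₗ[ℂ] (F i).X) :=
    isCPMap_of_map_star_mul _ fun x y => by simp [map_star]
  have hproj (i) : IsCPMap (LinearMap.proj i : (∀ i, (F i).X) →ₗ[ℂ] (F i).X) :=
    isCPMap_of_map_star_mul _ fun x y => by simp
  have hcomp (i) : (φ ∘ₗ J) ∘ₗ LinearMap.single ℂ (fun j => (G j).X) i =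
      (φ ∘ₗ LinearMap.single ℂ (fun j => (F j).X) i) ∘ₗ (j i : (G i).X →ₗ[ℂ] (F i).X) := by
    rw [LinearMap.comp_assoc, hJsingle, LinearMap.comp_assoc]
  refine ⟨G, LinearMap.pi fun i => E i ∘ₗ LinearMap.proj i ∘ₗ ψ, φ ∘ₗ J, hG,
    ⟨isCPMap_pi fun i => (hEcp i).comp ((hproj i).comp hψ.1), fun a => ?_⟩, hφ.comp hJcp,
    fun i => ⟨?_, ?_, fun x => ?_⟩, fun a ha => ?_⟩
  · refine (pi_norm_le_iff_of_nonneg (norm_nonneg a)).2 fun i => ?_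
    exact (hEnorm i _).trans ((norm_le_pi_norm (ψ a) i).trans (hψ.2 a))
  · rw [hcomp]
    exact (hφi i).1.comp (hjcp i)
  · rw [hcomp]
    rintro _ _ ⟨x, rfl⟩ ⟨y, rfl⟩ hxy
    refine (hφi i).2.1 _ _ ⟨j i x, by simp [map_star]⟩ ⟨j i y, by simp [map_star]⟩ ?_
    have := congr_arg (j i) hxy
    rwa [map_mul, map_zero] at this
  · rw [← LinearMap.comp_apply, hcomp]
    exact ((hφi i).2.2 _).trans (NonUnitalStarAlgHom.norm_map (j i) (hj i) x).le
  · rw [LinearMap.comp_apply, ← map_sub]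
    refine (norm_le_sum_norm_of_single φ (fun i => (hφi i).2.2) _).trans ?_
    have hi (i) : ‖j i (E i (ψ a i)) - ψ a i‖ ≤ 2 * ε := by
      obtain ⟨c, hc⟩ := happrox i (ψ a i) (Finset.mem_image_of_mem _ ha)
      have h1 : j i (E i (ψ a i)) - ψ a i =
          j i (E i (ψ a i - j i c)) - (ψ a i - j i c) := by
        rw [map_sub, map_sub, hEj]; abel
      have h2 := (NonUnitalStarAlgHom.norm_map (j i) (hj i) (E i (ψ a i - j i c))).trans_le
        (hEnorm i (ψ a i - j i c))
      rw [h1]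
      linarith [norm_sub_le (j i (E i (ψ a i - j i c))) (ψ a i - j i c)]
    calc _ ≤ ∑ _i : Fin (n + 1), 2 * ε := Finset.sum_le_sum fun i _ => hi i
      _ = (n + 1) * (2 * ε) := by simp

end Factorization

/-- Let `n ∈ ℕ`, let `A` be a separable C*-algebra and for
each `m` let `β_m : A → B_m` be a *-homomorphism into a C*-algebra `B_m`.
If the sequence `(β_m)` has an asymptotic order-`n` factorization through AF
algebras, then it has one through finite-dimensional C*-algebras. -/
theorem asympFactorization_FD_of_AF (n : ℕ) (A : CStarBundle)
    (hsep : TopologicalSpace.SeparableSpace A.X)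
    (B : ℕ → CStarBundle) (β : ∀ m, A.X →⋆ₙₐ[ℂ] (B m).X)
    (h : HasAsympFactorization n IsAFAlgebra A B β) :
    HasAsympFactorization n IsFDAlgebra A B β := by
  obtain ⟨F, ψ, φ, hF, hψ, hφ, hφi, hlim⟩ := h
  let d : ℕ → A.X := TopologicalSpace.denseSeq A.X
  have hd : DenseRange d := TopologicalSpace.denseRange_denseSeq A.X
  classical
  choose G ψ' φ' hG hψ' hφ' hφi' happrox using fun m : ℕ =>
    exists_finiteDimensional_factorization (hF m) (hψ m) (hφ m) (hφi m)
      ((Finset.range (m + 1)).image d) (Nat.one_div_pos_of_nat (α := ℝ) (n := m))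
  refine ⟨G, ψ', φ', hG, hψ', hφ', hφi', fun a => ?_⟩
  have hbound (m) (x : A.X) : ‖φ' m (ψ' m x)‖ ≤ (n + 1) * ‖x‖ := by
    refine (norm_le_sum_norm_of_single (φ' m) (fun i => (hφi' m i).2.2) _).trans ?_
    calc _ ≤ ∑ _i : Fin (n + 1), ‖x‖ := Finset.sum_le_sum fun i _ =>
          (norm_le_pi_norm (ψ' m x) i).trans ((hψ' m).2 x)
      _ = (n + 1) * ‖x‖ := by simp
  have hβ (m) (x : A.X) : ‖β m x‖ ≤ ‖x‖ := NonUnitalStarAlgHom.norm_apply_le (β m) x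
  have hdlim (k : ℕ) :
      Filter.Tendsto (fun m => ‖φ' m (ψ' m (d k)) - β m (d k)‖) Filter.atTop (nhds 0) := by
    have hsmall : Filter.Tendsto (fun m : ℕ => ((n : ℝ) + 1) * (2 * (1 / ((m : ℝ) + 1))))
        Filter.atTop (nhds 0) := by
      simpa using (tendsto_one_div_add_atTop_nhds_zero_nat (𝕜 := ℝ)).const_mul 2 |>.const_mul
        ((n : ℝ) + 1)
    have hsum := hsmall.add (hlim (d k))
    rw [add_zero] at hsum
    refine squeeze_zero' (Filter.Eventually.of_forall fun _ => norm_nonneg _) ?_ hsum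
    filter_upwards [Filter.eventually_ge_atTop k] with m hm
    have h1 := happrox m (d k)
      (Finset.mem_image_of_mem d (Finset.mem_range.2 (Nat.lt_succ_of_le hm)))
    exact (norm_sub_le_norm_sub_add_norm_sub _ (φ m (ψ m (d k))) _).trans (by gcongr)
  rw [Metric.tendsto_atTop]
  intro ε hε
  obtain ⟨k, hk⟩ := hd.exists_dist_lt a (show 0 < ε / (2 * (n + 2)) by positivity)
  obtain ⟨N, hN⟩ := Metric.tendsto_atTop.1 (hdlim k) (ε / 2) (half_pos hε)
  refine ⟨N, fun m hm => ?_⟩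
  have h1 := hN m hm
  rw [Real.dist_0_eq_abs, abs_norm] at h1 ⊢
  rw [dist_eq_norm, lt_div_iff₀ (by positivity)] at hk
  have hsplit : φ' m (ψ' m a) - β m a = φ' m (ψ' m (a - d k)) +
      (φ' m (ψ' m (d k)) - β m (d k)) - β m (a - d k) := by
    simp only [map_sub]; abel
  rw [hsplit]
  have h2 := norm_sub_le (φ' m (ψ' m (a - d k)) + (φ' m (ψ' m (d k)) - β m (d k)))
    (β m (a - d k))
  have h3 := norm_add_le (φ' m (ψ' m (a - d k))) (φ' m (ψ' m (d k)) - β m (d k))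
  nlinarith [hbound m (a - d k), hβ m (a - d k)]
end
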